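/- arXiv:2106.15418 — 2 statements merged into one kernel-verified Lean document; each statement's English description precedes it below -/
import Mathlib

section
/- Let (sigma, tilde-sigma) be a Kreweras pair with blocks B_1,...,B_{n+1} and vectors v_k as defined from the blocks with signs (-1)^b. Then v_1 ∧ v_2 ∧ ... ∧ v_{n+1} = ± f_sigma, where f_sigma = sum over pairs (I, Ĩ) concordant with (sigma, tilde-sigma) of e_{I,Ĩ}. -/
/-- Noncrossing condition for a partition of {0,…,m-1}. -/
def IsNoncrossing {m : ℕ} (P : Finpartition (Finset.univ : Finset (Fin m))) : Prop :=
  ∀ B ∈ P.parts, ∀ B' ∈ P.parts, B ≠ B' →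
    ¬ ∃ a b c d : Fin m, a < b ∧ b < c ∧ c < d ∧
      a ∈ B ∧ c ∈ B ∧ b ∈ B' ∧ d ∈ B'

/-- Encoding of [n] ⊔ [ñ] inside Fin (2n): the element i of [n] (1-based) is
2(i-1), the element ĩ of [ñ] is 2(i-1)+1, matching the circular order
1, 1̃, 2, 2̃, …, n, ñ. A Kreweras pair (σ, σ̃) is encoded as a single partition of
Fin (2n): it is noncrossing, each block lies entirely in [n] or in [ñ], and
there are n + 1 blocks in total. -/
def IsKrewerasPair {n : ℕ}
    (P : Finpartition (Finset.univ : Finset (Fin (2 * n)))) : Prop :=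
  IsNoncrossing P ∧
  (∀ B ∈ P.parts, (∀ x ∈ B, (x : ℕ) % 2 = 0) ∨ (∀ x ∈ B, (x : ℕ) % 2 = 1)) ∧
  P.parts.card = n + 1

/-- The wedge e_{I,Ĩ} of the standard basis vectors of ℝ^{2n} indexed by the
(n+1)-element set A, taken in increasing order. -/
noncomputable def eWedge (n : ℕ) (A : Finset (Fin (2 * n))) (h : A.card = n + 1) :
    ExteriorAlgebra ℝ (Fin (2 * n) → ℝ) :=
  ExteriorAlgebra.ιMulti ℝ (n + 1)
    (fun i => Pi.single ((A.orderIsoOfFin h i : Fin (2 * n))) (1 : ℝ))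

/-- A subset A of [n] ⊔ [ñ] is concordant with the partition P when it meets
every block of P in exactly one element. -/
def Concordant {n : ℕ} (A : Finset (Fin (2 * n)))
    (P : Finpartition (Finset.univ : Finset (Fin (2 * n)))) : Prop :=
  ∀ B ∈ P.parts, (A ∩ B).card = 1

instance {n : ℕ} (A : Finset (Fin (2 * n)))
    (P : Finpartition (Finset.univ : Finset (Fin (2 * n)))) :
    Decidable (Concordant A P) :=
  Finset.decidableDforallFinset

/-- Lam's vector f_σ = ∑_{(I,Ĩ) concordant with (σ,σ̃)} e_{I,Ĩ}, where the
Kreweras pair (σ,σ̃) is encoded as the partition P of Fin (2n). -/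
noncomputable def fSigma (n : ℕ)
    (P : Finpartition (Finset.univ : Finset (Fin (2 * n)))) :
    ExteriorAlgebra ℝ (Fin (2 * n) → ℝ) :=
  ∑ A ∈ ((Finset.univ : Finset (Fin (2 * n))).powersetCard (n + 1)).attach,
    if Concordant A.1 P then
      eWedge n A.1 (Finset.mem_powersetCard.mp A.2).2
    else 0

/-- The vector associated to a block B of a Kreweras pair (signs (-1)^b with
1-based b; index k of Fin (2n) corresponds to b = k/2 + 1). -/
def blockVec {n : ℕ} (B : Finset (Fin (2 * n))) : Fin (2 * n) → ℝ :=
  fun k => if k ∈ B then (-1 : ℝ) ^ ((k : ℕ) / 2 + 1) else 0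

/-- Davenport–Schinzel bound of order two: a word in `k` letters without equal neighbours and
without an alternating subsequence `abab` has length at most `2 * k - 1`. -/
theorem List.length_add_one_le_two_mul_card_toFinset {α : Type*} [DecidableEq α] (w : List α)
    (hw : w ≠ []) (hadj : w.IsChain (· ≠ ·))
    (hnc : ∀ a b, a ≠ b → ¬ [a, b, a, b].Sublist w) :
    w.length + 1 ≤ 2 * w.toFinset.card := by
  induction h : w.length using Nat.strong_induction_on generalizing w with
  | _ L ih =>
  subst h
  match w, hw with
  | a :: w, _ =>
  by_cases ha : a ∈ w
  · obtain ⟨u, v, rfl, hau⟩ := List.eq_append_cons_of_mem ha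
    have hu : u ≠ [] := by
      rintro rfl
      simp at hadj
    have hadj' : (u ++ a :: v).IsChain (· ≠ ·) := hadj.tail
    have h1 := ih u.length (by simp) u hu hadj'.left_of_append
      (fun x y hxy hs => hnc x y hxy
        ((hs.trans (List.sublist_append_left u (a :: v))).trans (List.sublist_cons_self _ _))) rfl
    have h2 := ih (a :: v).length (by simp) (a :: v) (by simp) hadj'.right_of_append
      (fun x y hxy hs => hnc x y hxy
        ((hs.trans (List.sublist_append_right u (a :: v))).trans (List.sublist_cons_self _ _))) rfl
    have hdisj : _root_.Disjoint u.toFinset (a :: v).toFinset := by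
      rw [Finset.disjoint_left]
      intro c hcu hcv
      rw [List.mem_toFinset] at hcu hcv
      have hca : c ≠ a := fun h => hau (h ▸ hcu)
      have hcv' : c ∈ v := by simpa [hca] using hcv
      refine hnc a c hca.symm ?_
      have s1 : [c].Sublist u := List.singleton_sublist.mpr hcu
      have s2 : [c].Sublist v := List.singleton_sublist.mpr hcv'
      exact (s1.append (s2.cons_cons a)).cons_cons a
    have hset : (a :: (u ++ a :: v)).toFinset = u.toFinset ∪ (a :: v).toFinset := by
      ext c; simp
    rw [hset, Finset.card_union_of_disjoint hdisj]
    simp only [List.length_cons, List.length_append] at h2 ⊢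
    omega
  · rw [List.toFinset_cons, Finset.card_insert_of_notMem (by simpa using ha)]
    by_cases hw : w = []
    · subst hw; simp
    have := ih w.length (by simp) w hw hadj.tail
      (fun x y hxy hs => hnc x y hxy (hs.trans (List.sublist_cons_self _ _))) rfl
    simp only [List.length_cons]
    omega

/-- In an extremal `abab`-free word of even length, the number of letters other than `c` between
two occurrences of `c` at even distance is half that distance. -/
theorem List.card_toFinset_erase_of_extremal {α : Type*} [DecidableEq α] {n m : ℕ}
    (u s t : List α) (c : α)
    (hadj : (u ++ c :: (s ++ c :: t)).IsChain (· ≠ ·))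
    (hnc : ∀ a b, a ≠ b → ¬ [a, b, a, b].Sublist (u ++ c :: (s ++ c :: t)))
    (hlen : (u ++ c :: (s ++ c :: t)).length = 2 * n)
    (hcard : (u ++ c :: (s ++ c :: t)).toFinset.card = n + 1) (hs : s.length + 1 = 2 * m) :
    (s.toFinset.erase c).card = m := by
  have hcs : (c :: s).Sublist (u ++ c :: (s ++ c :: t)) :=
    ((List.sublist_append_left s (c :: t)).cons_cons c).trans (List.sublist_append_right u _)
  have hct : (u ++ c :: t).Sublist (u ++ c :: (s ++ c :: t)) :=
    ((List.sublist_append_right s (c :: t)).trans (List.sublist_cons_self _ _)).append_left u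
  have h1 := List.length_add_one_le_two_mul_card_toFinset (c :: s) (by simp)
    (List.IsChain.left_of_append (l₂ := c :: t) (by simpa using hadj.right_of_append))
    (fun a b hab h => hnc a b hab (h.trans hcs))
  have h2 := List.length_add_one_le_two_mul_card_toFinset (u ++ c :: t) (by simp)
    (by
      rw [List.isChain_append] at hadj ⊢
      refine ⟨hadj.1, List.IsChain.right_of_append (l₁ := c :: s) (by simpa using hadj.2.1), ?_⟩
      simpa using hadj.2.2)
    (fun a b hab h => hnc a b hab (h.trans hct))
  have hdisj : _root_.Disjoint (s.toFinset.erase c) (u ++ c :: t).toFinset := by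
    rw [Finset.disjoint_left]
    intro d hd hd'
    rw [Finset.mem_erase, List.mem_toFinset] at hd
    simp only [List.mem_toFinset, List.mem_append, List.mem_cons, hd.1, false_or] at hd'
    have s1 : [d].Sublist s := List.singleton_sublist.mpr hd.2
    rcases hd' with h | h
    · refine hnc d c hd.1 ?_
      have s2 : [d].Sublist u := List.singleton_sublist.mpr h
      have s3 : [c].Sublist (c :: t) := List.singleton_sublist.mpr (by simp)
      exact s2.append ((s1.append s3).cons_cons c)
    · refine hnc c d (Ne.symm hd.1) ?_
      have s2 : [d].Sublist t := List.singleton_sublist.mpr h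
      exact ((s1.append (s2.cons_cons c)).cons_cons c).trans (List.sublist_append_right u _)
  have hset : (u ++ c :: (s ++ c :: t)).toFinset
      = s.toFinset.erase c ∪ (u ++ c :: t).toFinset := by
    ext d
    simp only [List.mem_toFinset, List.mem_append, List.mem_cons, Finset.mem_union,
      Finset.mem_erase]
    tauto
  rw [hset, Finset.card_union_of_disjoint hdisj] at hcard
  have h3 : (c :: s).toFinset.card = (s.toFinset.erase c).card + 1 := by
    have : (c :: s).toFinset = insert c (s.toFinset.erase c) := by
      ext d
      simp only [List.toFinset_cons, Finset.mem_insert, Finset.mem_erase]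
      tauto
    rw [this, Finset.card_insert_of_notMem (by simp)]
  simp only [List.length_cons, List.length_append] at h1 h2 hlen
  omega

/-- For a labelling `f` of `Fin (2 * n)` by all of `Fin (n + 1)` that is noncrossing and respects
parity, the number of labels other than `f x` occurring between two points `x < y` with the same
label is `(y - x) / 2`. -/
theorem card_labels_between {n : ℕ} (f : Fin (2 * n) → Fin (n + 1))
    (hsurj : Function.Surjective f)
    (hpar : ∀ i j, f i = f j → (i : ℕ) % 2 = (j : ℕ) % 2)
    (hnc : ∀ a b c d, a < b → b < c → c < d → f a = f c → f b = f d → f a = f b)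
    {x y : Fin (2 * n)} (hxy : x < y) (hf : f x = f y) :
    (Finset.univ.filter fun i => i ≠ f x ∧ ∃ z, x < z ∧ z < y ∧ f z = i).card
      = ((y : ℕ) - x) / 2 := by
  obtain ⟨g, hg⟩ : ∃ g : ℕ → Fin (n + 1), ∀ z : Fin (2 * n), g z = f z :=
    ⟨fun z => if h : z < 2 * n then f ⟨z, h⟩ else 0, fun z => by simp⟩
  have hg' : ∀ z (h : z < 2 * n), g z = f ⟨z, h⟩ := fun z h => hg ⟨z, h⟩
  have hp := hpar x y hf
  have hx := x.2
  have hy := y.2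
  have hlt : (x : ℕ) < y := hxy
  set s := (List.range' (x + 1) (y - x - 1)).map g with hs
  have hw : (List.range' 0 (2 * n)).map g = (List.range' 0 x).map g ++ g x ::
      (s ++ g x :: (List.range' (y + 1) (2 * n - y - 1)).map g) := by
    have hgy : g x = g y := by rw [hg, hg, hf]
    have e1 : List.range' 0 (2 * n) = List.range' 0 x ++ (x : ℕ) ::
        (List.range' (x + 1) (y - x - 1) ++ (y : ℕ) :: List.range' (y + 1) (2 * n - y - 1)) := by
      have a1 : (y : ℕ) :: List.range' (y + 1) (2 * n - y - 1) = List.range' y (2 * n - y) := by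
        rw [← List.range'_succ]; congr 1; omega
      have a2 : List.range' (x + 1) (y - x - 1) ++ List.range' y (2 * n - y)
          = List.range' (x + 1) (2 * n - x - 1) := by
        have : (y : ℕ) = x + 1 + 1 * (y - x - 1) := by omega
        conv_lhs => rw [this]
        rw [show x + 1 + 1 * ((y : ℕ) - x - 1) - x - 1 = (y : ℕ) - x - 1 by omega,
          List.range'_append]
        congr 1; omega
      have a3 : (x : ℕ) :: List.range' (x + 1) (2 * n - x - 1) = List.range' x (2 * n - x) := by
        rw [← List.range'_succ]; congr 1; omega
      rw [a1, a2, a3]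
      have := List.range'_append (s := 0) (m := x) (n := 2 * n - x) (step := 1)
      rw [show 0 + 1 * (x : ℕ) = x by omega] at this
      rw [this]
      congr 1; omega
    rw [e1]
    simp [hs, ← hgy]
  have key := List.card_toFinset_erase_of_extremal (n := n) (m := (y - x) / 2)
    ((List.range' 0 x).map g) s ((List.range' (y + 1) (2 * n - y - 1)).map g) (g x)
    (by
      rw [← hw, List.isChain_map, List.isChain_iff_getElem]
      intro i hi
      simp only [List.length_range'] at hi
      simp only [List.getElem_range']
      intro h
      rw [hg' _ (by omega), hg' _ (by omega)] at h
      have := hpar _ _ h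
      simp only at this
      omega)
    (by
      rw [← hw]
      intro a b hab h
      rw [List.sublist_map_iff] at h
      obtain ⟨l, hl, he⟩ := h
      have hsort : l.Pairwise (· < ·) := (List.pairwise_lt_range' (s := 0) (n := 2 * n)).sublist hl
      have hmem : ∀ z ∈ l, z < 2 * n := fun z hz => by
        simpa using hl.subset hz
      have hl4 : l.length = 4 := by simpa using (congrArg List.length he).symm
      obtain ⟨p, q, r, t, rfl⟩ : ∃ p q r t, l = [p, q, r, t] := by
        match l, hl4 with
        | [p, q, r, t], _ => exact ⟨p, q, r, t, rfl⟩
      simp only [List.map_cons, List.map_nil, List.cons.injEq, and_true] at he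
      simp only [List.pairwise_cons, List.mem_cons] at hsort
      have hp := hmem p (by simp)
      have hq := hmem q (by simp)
      have hr := hmem r (by simp)
      have ht := hmem t (by simp)
      rw [hg' _ hp, hg' _ hq, hg' _ hr, hg' _ ht] at he
      refine hab ?_
      rw [he.1, he.2.1]
      exact hnc ⟨p, hp⟩ ⟨q, hq⟩ ⟨r, hr⟩ ⟨t, ht⟩ (hsort.1 q (by simp)) (hsort.2.1 r (by simp))
        (hsort.2.2.1 t (by simp)) (he.1.symm.trans he.2.2.1) (he.2.1.symm.trans he.2.2.2))
    (by rw [← hw]; simp)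
    (by
      rw [← hw]
      have : ((List.range' 0 (2 * n)).map g).toFinset = Finset.univ := by
        ext i
        obtain ⟨z, rfl⟩ := hsurj i
        simp only [List.mem_toFinset, List.mem_map, Finset.mem_univ, iff_true]
        exact ⟨z, by simp, hg z⟩
      rw [this]; simp)
    (by simp only [hs, List.length_map, List.length_range']; omega)
  rw [← key]
  congr 1
  ext i
  simp only [Finset.mem_filter, Finset.mem_univ, true_and, Finset.mem_erase, List.mem_toFinset,
    hs, List.mem_map, List.mem_range'_1, hg]
  refine and_congr_right fun _ => ⟨?_, ?_⟩
  · rintro ⟨z, h1, h2, rfl⟩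
    exact ⟨z, by rw [Fin.lt_def] at h1 h2; omega, hg z⟩
  · rintro ⟨z, hz, rfl⟩
    exact ⟨⟨z, by omega⟩, by rw [Fin.lt_def]; simp only; omega,
      by rw [Fin.lt_def]; simp only; omega, (hg' z _).symm⟩

/-- The sign `(-1)` to the number of inversions of an injective map between linear orders. -/
def inversionSign {n : ℕ} {β : Type*} [LinearOrder β] (r : Fin n → β) : ℤ :=
  ∏ j, ∏ i ∈ Finset.Iio j, if r i < r j then 1 else -1

theorem inversionSign_eq_one_or {n : ℕ} {β : Type*} [LinearOrder β] (r : Fin n → β) :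
    inversionSign r = 1 ∨ inversionSign r = -1 := by
  rw [← abs_eq zero_le_one]
  simp only [inversionSign, Finset.abs_prod]
  refine Finset.prod_eq_one fun j _ => Finset.prod_eq_one fun i _ => ?_
  split_ifs <;> simp

/-- Replacing the value at `k` by a larger one changes the inversion sign by the parity of the
number of values jumped over. -/
theorem inversionSign_update {n : ℕ} {β : Type*} [LinearOrder β] (r : Fin n → β) (k : Fin n)
    (y : β) (hr : Function.Injective r) (hy : ∀ i, i ≠ k → r i ≠ y) (hky : r k < y) :
    inversionSign (Function.update r k y) = inversionSign r *
      (-1) ^ (Finset.univ.filter fun i => r k < r i ∧ r i < y).card := by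
  set h : Fin n → ℤ := fun i => if r k < r i ∧ r i < y then -1 else 1 with hh
  have hfac : ∀ j, ∀ i ∈ Finset.Iio j,
      (if Function.update r k y i < Function.update r k y j then (1 : ℤ) else -1) =
      (if r i < r j then 1 else -1) * ((if j = k then h i else 1) * (if i = k then h j else 1)) := by
    intro j i hij
    rw [Finset.mem_Iio] at hij
    by_cases hj : j = k
    · subst hj
      have hi : i ≠ j := hij.ne
      have h1 := hy i hi
      have h2 := hr.ne hi
      simp only [Function.update_self, Function.update_of_ne hi, if_true, if_neg hi, hh]
      rcases lt_or_gt_of_ne h1 with h1 | h1 <;> rcases lt_or_gt_of_ne h2 with h2 | h2 <;>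
        simp [h1, h2, h1.not_gt, h2.not_gt]
      exact absurd (h1.trans (h2.trans hky)) (lt_irrefl _)
    · by_cases hi : i = k
      · subst hi
        have h1 := hy j hj
        have h2 := hr.ne hj
        simp only [Function.update_self, Function.update_of_ne hj, if_true, if_neg hj, hh]
        rcases lt_or_gt_of_ne h1 with h1 | h1 <;> rcases lt_or_gt_of_ne h2 with h2 | h2 <;>
          simp [h1, h2, h1.not_gt, h2.not_gt]
        exact absurd (h1.trans (h2.trans hky)) (lt_irrefl _)
      · simp [hi, hj]
  have hprod : ∏ j, ∏ i ∈ Finset.Iio j,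
      ((if j = k then h i else 1) * (if i = k then h j else 1)) = ∏ i, h i := by
    simp only [Finset.prod_mul_distrib]
    have e1 : ∏ j, ∏ i ∈ Finset.Iio j, (if j = k then h i else 1) = ∏ i ∈ Finset.Iio k, h i := by
      rw [Finset.prod_eq_single k] <;> simp +contextual
    have e2 : ∏ j, ∏ i ∈ Finset.Iio j, (if i = k then h j else 1) = ∏ i ∈ Finset.Ioi k, h i := by
      simp only [Finset.prod_ite_eq', Finset.mem_Iio]
      rw [← Finset.prod_filter]
      congr 1; ext; simp
    rw [e1, e2, ← Finset.prod_union (Finset.disjoint_left.mpr fun i hi hi' =>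
      lt_asymm (Finset.mem_Iio.mp hi) (Finset.mem_Ioi.mp hi'))]
    refine Finset.prod_subset (Finset.subset_univ _) fun i _ hi => ?_
    have : i = k := by simpa [not_or, le_antisymm_iff, and_comm] using hi
    simp [hh, this]
  have hpow : ∏ i, h i = (-1) ^ (Finset.univ.filter fun i => r k < r i ∧ r i < y).card := by
    simp [hh, Finset.prod_ite]
  rw [← hpow, ← hprod, inversionSign, inversionSign, ← Finset.prod_mul_distrib]
  refine Finset.prod_congr rfl fun j _ => ?_
  rw [← Finset.prod_mul_distrib]
  exact Finset.prod_congr rfl (hfac j)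

/-- Sorting the factors of a wedge of basis vectors produces the inversion sign. -/
theorem ιMulti_single_eq_inversionSign_smul_eWedge {n : ℕ} (r : Fin (n + 1) → Fin (2 * n))
    (hr : Function.Injective r) (A : Finset (Fin (2 * n))) (hA : A.card = n + 1)
    (hrA : ∀ i, r i ∈ A) :
    ExteriorAlgebra.ιMulti ℝ (n + 1) (fun i => Pi.single (r i) (1 : ℝ))
      = (inversionSign r : ℝ) • eWedge n A hA := by
  set o := A.orderIsoOfFin hA
  let φ : Fin (n + 1) → Fin (n + 1) := fun i => o.symm ⟨r i, hrA i⟩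
  have hφ : Function.Injective φ := fun i j hij => hr (by simpa [φ] using hij)
  let τ : Equiv.Perm (Fin (n + 1)) := Equiv.ofBijective φ hφ.bijective_of_finite
  have hτ : ∀ i, (o (τ i) : Fin (2 * n)) = r i := fun i => by simp [τ, φ]
  have hsign : inversionSign r = (Equiv.Perm.sign τ : ℤ) := by
    rw [Equiv.Perm.sign_eq_prod_prod_Iio, inversionSign]
    push_cast
    refine Finset.prod_congr rfl fun j _ => Finset.prod_congr rfl fun i _ => ?_
    have : τ i < τ j ↔ r i < r j := by
      rw [← hτ i, ← hτ j, Subtype.coe_lt_coe, o.lt_iff_lt]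
    simp only [this]
    split_ifs <;> simp
  have := (ExteriorAlgebra.ιMulti ℝ (n + 1) (M := Fin (2 * n) → ℝ)).map_perm
    (fun i => Pi.single (o i : Fin (2 * n)) (1 : ℝ)) τ
  simp only [Function.comp_def, hτ] at this
  rw [this, hsign, Int.cast_smul_eq_zsmul, Units.smul_def]
  rfl

/-- The coefficient with which a transversal `r` contributes to the wedge of the block vectors. -/
noncomputable def transversalSign {n : ℕ} (r : Fin (n + 1) → Fin (2 * n)) : ℝ :=
  (inversionSign r : ℝ) * ∏ i, (-1 : ℝ) ^ ((r i : ℕ) / 2 + 1)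

theorem transversalSign_eq_one_or {n : ℕ} (r : Fin (n + 1) → Fin (2 * n)) :
    transversalSign r = 1 ∨ transversalSign r = -1 := by
  rw [transversalSign, Finset.prod_pow_eq_pow_sum]
  rcases inversionSign_eq_one_or r with h | h <;>
    rcases neg_one_pow_eq_or ℝ (∑ i, ((r i : ℕ) / 2 + 1)) with h' | h' <;> simp [h, h']

theorem transversalSign_update_of_lt {n : ℕ} (f : Fin (2 * n) → Fin (n + 1))
    (hpar : ∀ i j, f i = f j → (i : ℕ) % 2 = (j : ℕ) % 2)
    (hnc : ∀ a b c d, a < b → b < c → c < d → f a = f c → f b = f d → f a = f b)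
    (r : Fin (n + 1) → Fin (2 * n)) (hr : ∀ i, f (r i) = i) (k : Fin (n + 1))
    (y : Fin (2 * n)) (hy : f y = k) (hlt : r k < y) :
    transversalSign (Function.update r k y) = transversalSign r := by
  have hfk : f (r k) = f y := (hr k).trans hy.symm
  have hsurj : Function.Surjective f := fun i => ⟨r i, hr i⟩
  have hp := hpar _ _ hfk
  have hlt' : (r k : ℕ) < y := hlt
  have hcount : (Finset.univ.filter fun i => r k < r i ∧ r i < y).card = ((y : ℕ) - r k) / 2 := by
    rw [← card_labels_between f hsurj hpar hnc hlt hfk, hr]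
    congr 1
    ext i
    simp only [Finset.mem_filter, Finset.mem_univ, true_and]
    constructor
    · rintro ⟨h1, h2⟩
      exact ⟨by rintro rfl; exact lt_irrefl _ h1, r i, h1, h2, hr i⟩
    · rintro ⟨hik, z, h1, h2, hz⟩
      have hzi : f z = f (r i) := hz.trans (hr i).symm
      refine ⟨?_, ?_⟩
      · by_contra! h
        have h' : r i < r k := lt_of_le_of_ne h fun e => hik (by rw [← hr i, e, hr])
        exact hik (by rw [← hr i, hnc _ _ _ _ h' h1 h2 hzi.symm hfk, hr])
      · by_contra! h
        have h' : y < r i := lt_of_le_of_ne h fun e => hik (by rw [← hr i, ← e, hy])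
        exact hik (by rw [← hz, ← hnc _ _ _ _ h1 h2 h' hfk hzi, hr])
  rw [transversalSign, inversionSign_update r k y (fun i j h => by rw [← hr i, h, hr])
    (fun i hi h => hi (by rw [← hr i, h, hy])) hlt, hcount]
  have hS : ∏ i, (-1 : ℝ) ^ ((Function.update r k y i : ℕ) / 2 + 1)
      = (∏ i, (-1 : ℝ) ^ ((r i : ℕ) / 2 + 1)) * (-1) ^ (((y : ℕ) - r k) / 2) := by
    have : ∀ i, (-1 : ℝ) ^ ((Function.update r k y i : ℕ) / 2 + 1)
        = (-1 : ℝ) ^ ((r i : ℕ) / 2 + 1) * if i = k then (-1) ^ (((y : ℕ) - r k) / 2) else 1 := by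
      intro i
      by_cases hi : i = k
      · subst hi
        rw [Function.update_self, if_pos rfl, ← pow_add]
        congr 1; omega
      · simp [hi]
    simp only [this, Finset.prod_mul_distrib, Finset.prod_ite_eq', Finset.mem_univ, if_true]
  rw [hS, transversalSign]
  push_cast
  have hsq : ((-1 : ℝ) ^ (((y : ℕ) - r k) / 2)) * (-1) ^ (((y : ℕ) - r k) / 2) = 1 := by
    rw [← mul_pow]; simp
  linear_combination ((inversionSign r : ℝ) * ∏ i, (-1 : ℝ) ^ ((r i : ℕ) / 2 + 1)) * hsq

/-- All transversals of an extremal noncrossing labelling contribute with the same sign. -/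
theorem transversalSign_eq {n : ℕ} (f : Fin (2 * n) → Fin (n + 1))
    (hpar : ∀ i j, f i = f j → (i : ℕ) % 2 = (j : ℕ) % 2)
    (hnc : ∀ a b c d, a < b → b < c → c < d → f a = f c → f b = f d → f a = f b)
    (r r' : Fin (n + 1) → Fin (2 * n)) (hr : ∀ i, f (r i) = i) (hr' : ∀ i, f (r' i) = i) :
    transversalSign r = transversalSign r' := by
  have hupd : ∀ r : Fin (n + 1) → Fin (2 * n), (∀ i, f (r i) = i) → ∀ k y, f y = k →
      transversalSign (Function.update r k y) = transversalSign r := by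
    intro r hr k y hy
    rcases lt_trichotomy (r k) y with h | rfl | h
    · exact transversalSign_update_of_lt f hpar hnc r hr k y hy h
    · rw [Function.update_eq_self]
    · have hr₂ : ∀ i, f (Function.update r k y i) = i := fun i => by
        by_cases hi : i = k
        · subst hi; simpa using hy
        · simpa [hi] using hr i
      have := transversalSign_update_of_lt f hpar hnc _ hr₂ k (r k) (hr k) (by simpa using h)
      rw [Function.update_idem, Function.update_eq_self] at this
      exact this.symm
  have hpw : ∀ s : Finset (Fin (n + 1)), transversalSign (s.piecewise r r') = transversalSign r' := by
    intro s
    induction s using Finset.induction_on with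
    | empty => simp
    | insert k s _ ih =>
      rw [Finset.piecewise_insert, hupd _ _ k _ (hr k), ih]
      intro i
      by_cases hi : i ∈ s <;> simp [hi, hr, hr']
  simpa using hpw Finset.univ

/-- For a Kreweras pair (σ, σ̃) with blocks B₁, …, B_{n+1} and associated
vectors v₁, …, v_{n+1}, we have v₁ ∧ v₂ ∧ … ∧ v_{n+1} = ± f_σ. -/
theorem blockVec_wedge_eq_pm_fSigma (n : ℕ)
    (P : Finpartition (Finset.univ : Finset (Fin (2 * n))))
    (hP : IsKrewerasPair P)
    (b : Fin (n + 1) → Finset (Fin (2 * n)))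
    (hb : Function.Injective b) (hbP : ∀ k, b k ∈ P.parts) :
    ExteriorAlgebra.ιMulti ℝ (n + 1) (fun k => blockVec (b k)) = fSigma n P ∨
    ExteriorAlgebra.ιMulti ℝ (n + 1) (fun k => blockVec (b k)) = -fSigma n P := by
  obtain ⟨hnc, hpar, hcard⟩ := hP
  have himg : Finset.univ.image b = P.parts := by
    refine Finset.eq_of_subset_of_card_le (by simpa [Finset.image_subset_iff] using hbP) ?_
    rw [Finset.card_image_of_injective _ hb, hcard]
    simp
  have hlabel : ∀ x : Fin (2 * n), ∃ k, x ∈ b k := by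
    intro x
    obtain ⟨B, hB, hx⟩ := P.exists_mem (Finset.mem_univ x)
    rw [← himg, Finset.mem_image] at hB
    obtain ⟨k, _, rfl⟩ := hB
    exact ⟨k, hx⟩
  choose f hf using hlabel
  have hmem : ∀ x k, x ∈ b k ↔ f x = k := by
    refine fun x k => ⟨fun hx => hb ?_, fun h => h ▸ hf x⟩
    exact P.eq_of_mem_parts (hbP _) (hbP _) (hf x) hx
  have hpar' : ∀ i j, f i = f j → (i : ℕ) % 2 = (j : ℕ) % 2 := by
    intro i j hij
    have hi := hf i
    have hj := (hmem j (f i)).mpr hij.symm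
    rcases hpar _ (hbP (f i)) with h | h <;> rw [h i hi, h j hj]
  have hnc' : ∀ a b c d, a < b → b < c → c < d → f a = f c → f b = f d → f a = f b := by
    intro p q s t hpq hqs hst hps hqt
    by_contra hne
    exact hnc _ (hbP (f p)) _ (hbP (f q)) (hb.ne hne) ⟨p, q, s, t, hpq, hqs, hst, hf p,
      (hmem _ _).mpr hps.symm, hf q, (hmem _ _).mpr hqt.symm⟩
  choose r₀ hr₀ using fun k => P.nonempty_of_mem_parts (hbP k)
  have hpi : ∀ r ∈ Fintype.piFinset b, ∀ i, f (r i) = i := fun r hr i =>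
    (hmem _ _).mp (Fintype.mem_piFinset.mp hr i)
  have hinj : ∀ r ∈ Fintype.piFinset b, Function.Injective r := fun r hr i j hij => by
    rw [← hpi r hr i, hij, hpi r hr]
  have hcardim : ∀ r ∈ Fintype.piFinset b, (Finset.univ.image r).card = n + 1 := fun r hr => by
    rw [Finset.card_image_of_injective _ (hinj r hr)]; simp
  have hinter : ∀ r ∈ Fintype.piFinset b, ∀ k, Finset.univ.image r ∩ b k = {r k} := by
    intro r hr k
    ext x
    simp only [Finset.mem_inter, Finset.mem_image, Finset.mem_univ, true_and, hmem,
      Finset.mem_singleton]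
    constructor
    · rintro ⟨⟨i, rfl⟩, hi⟩
      rw [hpi r hr] at hi
      rw [hi]
    · rintro rfl
      exact ⟨⟨k, rfl⟩, hpi r hr k⟩
  have hexp : ExteriorAlgebra.ιMulti ℝ (n + 1) (fun k => blockVec (b k))
      = transversalSign r₀ • fSigma n P := by
    have hv : (fun k => blockVec (b k)) = fun k => ∑ x ∈ b k,
        (-1 : ℝ) ^ ((x : ℕ) / 2 + 1) • (Pi.single x (1 : ℝ) : Fin (2 * n) → ℝ) := by
      funext k z
      simp [blockVec, Finset.sum_apply, Pi.single_apply]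
    rw [hv, ← AlternatingMap.coe_multilinearMap, MultilinearMap.map_sum_finset]
    rw [fSigma, ← Finset.sum_filter, Finset.smul_sum]
    refine Finset.sum_bij (fun r hr => ⟨Finset.univ.image r, Finset.mem_powersetCard.mpr
      ⟨Finset.subset_univ _, hcardim r hr⟩⟩) ?_ ?_ ?_ ?_
    · intro r hr
      simp only [Finset.mem_filter, Finset.mem_attach, true_and]
      intro B hB
      rw [← himg, Finset.mem_image] at hB
      obtain ⟨k, _, rfl⟩ := hB
      rw [hinter r hr, Finset.card_singleton]
    · intro r hr r' hr' h
      have h' : Finset.univ.image r = Finset.univ.image r' := congrArg Subtype.val h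
      funext k
      have := hinter r hr k
      rw [h', hinter r' hr' k] at this
      exact (Finset.singleton_injective this).symm
    · rintro ⟨A, hA⟩ hAc
      simp only [Finset.mem_filter, Finset.mem_attach, true_and] at hAc
      choose r hr using fun k => Finset.card_eq_one.mp (hAc (b k) (hbP k))
      have hrm : ∀ k, r k ∈ A ∩ b k := fun k => by rw [hr k]; simp
      have hrpi : r ∈ Fintype.piFinset b :=
        Fintype.mem_piFinset.mpr fun k => (Finset.mem_inter.mp (hrm k)).2
      refine ⟨r, hrpi, Subtype.ext ?_⟩
      refine Finset.eq_of_subset_of_card_le ?_ ?_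
      · intro x hx
        obtain ⟨k, _, rfl⟩ := Finset.mem_image.mp hx
        exact (Finset.mem_inter.mp (hrm k)).1
      · rw [hcardim r hrpi, (Finset.mem_powersetCard.mp hA).2]
    · intro r hr
      rw [MultilinearMap.map_smul_univ, AlternatingMap.coe_multilinearMap,
        ιMulti_single_eq_inversionSign_smul_eWedge r (hinj r hr) _ (hcardim r hr) (by simp),
        smul_smul, transversalSign_eq f hpar' hnc' r₀ r (fun k => (hmem _ _).mp (hr₀ k))
          (hpi r hr), transversalSign, mul_comm (inversionSign r : ℝ)]
  rcases transversalSign_eq_one_or r₀ with h | h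
  · left; rw [hexp, h, one_smul]
  · right; rw [hexp, h, neg_one_smul]
end

section
/- For any noncrossing partition sigma of [n], the vector f_sigma lies in the kernel of the map kappa: Λ^{n+1}(R^{2n}) → Λ^{n-1}(R^{2n}) induced by the form Omega. -/
/-- The unmarked coordinate `x_{i+1}` (0-based `i`) of a vector in ℝ^{2n}:
coordinates are listed in the order 1, 1̃, 2, 2̃, …, n, ñ. -/
def unmCoord {n : ℕ} (x : Fin (2 * n) → ℝ) (i : ℕ) : ℝ :=
  if h : 2 * i < 2 * n then x ⟨2 * i, h⟩ else 0

/-- The tilde coordinate `x_{(i+1)~}` (0-based `i`) of a vector in ℝ^{2n}. -/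
def tldCoord {n : ℕ} (x : Fin (2 * n) → ℝ) (i : ℕ) : ℝ :=
  if h : 2 * i + 1 < 2 * n then x ⟨2 * i + 1, h⟩ else 0

/-- The skew-symmetric bilinear form Ω on ℝ^{2n}. -/
def Omega (n : ℕ) (x y : Fin (2 * n) → ℝ) : ℝ :=
  (∑ i ∈ Finset.range n,
      (unmCoord x i * tldCoord y i - tldCoord x i * unmCoord y i)) +
  (∑ j ∈ Finset.range (n - 1),
      (unmCoord x (j + 1) * tldCoord y j - tldCoord x j * unmCoord y (j + 1))) +
  (-1 : ℝ) ^ n *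
      (unmCoord x 0 * tldCoord y (n - 1) - tldCoord x (n - 1) * unmCoord y 0)

/-- The skew-symmetric bilinear form Ω^D on ℝ^{2n}, with cyclic indices mod n. -/
def OmegaD (n : ℕ) (x y : Fin (2 * n) → ℝ) : ℝ :=
  (∑ i ∈ Finset.range n,
      (unmCoord x i * tldCoord y i - tldCoord x i * unmCoord y i)) +
  (∑ j ∈ Finset.range n,
      (tldCoord x j * unmCoord y ((j + 1) % n) -
        unmCoord x ((j + 1) % n) * tldCoord y j))

/-- The family obtained from v : Fin (n+1) → V by omitting the entries at
positions p < q, reindexed by Fin (n-1). -/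
def erase2 {α : Type*} {n : ℕ} (v : Fin (n + 1) → α) (p q : Fin (n + 1)) :
    Fin (n - 1) → α :=
  fun i => v ⟨(if (i : ℕ) < (p : ℕ) then (i : ℕ)
      else if (i : ℕ) + 1 < (q : ℕ) then (i : ℕ) + 1 else (i : ℕ) + 2) % (n + 1),
    Nat.mod_lt _ (Nat.succ_pos n)⟩

/-- The value of the map κ : Λ^{n+1}(V) → Λ^{n-1}(V) induced by a bilinear form
Ω on a simple tensor v₁ ∧ … ∧ v_{n+1}:
∑_{p<q} (-1)^{p+q-1} Ω(v_p, v_q) · v₁ ∧ … ∧ v̂_p ∧ … ∧ v̂_q ∧ … ∧ v_{n+1}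
(with 1-based p, q as in the paper; here indices are 0-based). -/
noncomputable def kappaSimple {n : ℕ} (V : Type*) [AddCommGroup V] [Module ℝ V]
    (Ω : V → V → ℝ) (v : Fin (n + 1) → V) : ExteriorAlgebra ℝ V :=
  ∑ p : Fin (n + 1), ∑ q : Fin (n + 1),
    if (p : ℕ) < (q : ℕ) then
      ((-1 : ℝ) ^ ((p : ℕ) + (q : ℕ) + 1) * Ω (v p) (v q)) •
        ExteriorAlgebra.ιMulti ℝ (n - 1) (erase2 v p q)
    else 0

/-- The ordered family of standard basis vectors indexed by an
(n+1)-element subset A; its wedge is e_{I,Ĩ}. -/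
noncomputable def basisFam (n : ℕ) (A : Finset (Fin (2 * n)))
    (h : A.card = n + 1) : Fin (n + 1) → (Fin (2 * n) → ℝ) :=
  fun i => Pi.single ((A.orderIsoOfFin h i : Fin (2 * n))) (1 : ℝ)

/-- A closed walk `w` of length `2 * n` without crossings and with `n + 1` vertices traverses every
edge once in each direction, so that sums alternating along the walk of a symmetric function of the
edges vanish. -/
theorem sum_closed_walk_eq_zero {β M : Type*} [DecidableEq β] [AddCommGroup M] [Module ℝ M]
    {n : ℕ} (w : ℕ → β) (hw : w (2 * n) = w 0) (hne : ∀ k < 2 * n, w k ≠ w (k + 1))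
    (hnc : ∀ a b c d, a < b → b < c → c < d → d < 2 * n → w a = w c → w b = w d → w a = w b)
    (hcard : ((Finset.range (2 * n)).image w).card = n + 1)
    (c : β → ℝ) (hc : ∀ k < 2 * n, c (w (k + 1)) = -c (w k))
    (G : β → β → M) (hG : ∀ x y, G x y = G y x) :
    ∑ k ∈ Finset.range (2 * n), c (w k) • G (w k) (w (k + 1)) = 0 := by
  classical
  have hnc' : ∀ a b c d, a < b → b < c → c < d → d ≤ 2 * n → w a = w c → w b = w d →
      w a = w b := by
    intro a b c d hab hbc hcd hd hac hbd
    rcases hd.lt_or_eq with hd | rfl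
    · exact hnc a b c d hab hbc hcd hd hac hbd
    · rcases Nat.eq_zero_or_pos a with rfl | ha
      · rw [hbd, hw]
      · have := hnc 0 a b c ha hab hbc hcd (by rw [hbd, hw]) hac
        rw [hbd, hw, this]
  set T := ((Finset.range (2 * n)).image w).erase (w 0) with hT
  have hpos : 0 < 2 * n := by
    rcases Nat.eq_zero_or_pos n with rfl | h
    · simp at hcard
    · omega
  have hTcard : T.card = n := by
    rw [hT, Finset.card_erase_of_mem, hcard, Nat.add_sub_cancel]
    exact Finset.mem_image_of_mem _ (Finset.mem_range.2 hpos)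
  have hfirst : ∀ B ∈ T, ∃ i < 2 * n, w (i + 1) = B ∧ ∀ j ≤ i, w j ≠ B := by
    intro B hB
    obtain ⟨hB0, hB⟩ := Finset.mem_erase.1 hB
    obtain ⟨k, hk, rfl⟩ := Finset.mem_image.1 hB
    have hex : ∃ j, w j = w k := ⟨k, rfl⟩
    have h1 := Nat.find_spec hex
    have h2 : Nat.find hex ≤ k := Nat.find_min' hex rfl
    have h3 : ∀ j < Nat.find hex, w j ≠ w k := fun j hj => Nat.find_min hex hj
    have h4 : Nat.find hex ≠ 0 := fun h => hB0 (by rw [h] at h1; exact h1.symm)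
    have hk := Finset.mem_range.1 hk
    refine ⟨Nat.find hex - 1, by omega, ?_, fun j hj => h3 j (by omega)⟩
    rwa [Nat.sub_add_cancel (Nat.pos_of_ne_zero h4)]
  have hlast : ∀ B ∈ T, ∃ k < 2 * n, w k = B ∧ ∀ j, k < j → j ≤ 2 * n → w j ≠ B := by
    intro B hB
    obtain ⟨hB0, hB⟩ := Finset.mem_erase.1 hB
    obtain ⟨k, hk, hkB⟩ := Finset.mem_image.1 hB
    have hk := Finset.mem_range.1 hk
    have h1 := Nat.findGreatest_spec (P := fun j => w j = B) hk.le hkB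
    have h2 : Nat.findGreatest (fun j => w j = B) (2 * n) ≤ 2 * n := Nat.findGreatest_le _
    refine ⟨Nat.findGreatest (fun j => w j = B) (2 * n), lt_of_le_of_ne h2 ?_, h1,
      fun j hj hj' => Nat.findGreatest_is_greatest hj hj'⟩
    intro h
    rw [h] at h1
    exact hB0 (by rw [← h1, hw])
  choose! i hi hiB hi_first using hfirst
  choose! l hl hlB hl_last using hlast
  have hi_inj : Set.InjOn i T := fun x hx y hy h => by rw [← hiB x hx, ← hiB y hy, h]
  have hl_inj : Set.InjOn l T := fun x hx y hy h => by rw [← hlB x hx, ← hlB y hy, h]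
  have hcover : T.image i ∪ T.image l = Finset.range (2 * n) := by
    apply Finset.Subset.antisymm
    · intro k hk
      rcases Finset.mem_union.1 hk with hk | hk <;> obtain ⟨B, hB, rfl⟩ := Finset.mem_image.1 hk
      · exact Finset.mem_range.2 (hi B hB)
      · exact Finset.mem_range.2 (hl B hB)
    · intro k hk
      have hk := Finset.mem_range.1 hk
      have hmem : ∀ j ≤ 2 * n, w j ∈ (Finset.range (2 * n)).image w := by
        intro j hj
        rcases hj.lt_or_eq with hj | rfl
        · exact Finset.mem_image_of_mem _ (Finset.mem_range.2 hj)
        · rw [hw]; exact Finset.mem_image_of_mem _ (Finset.mem_range.2 hpos)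
      by_contra hcon
      rw [Finset.mem_union, not_or] at hcon
      obtain ⟨h1, h2⟩ := hcon
      have hlater : ∃ d, k + 1 < d ∧ d ≤ 2 * n ∧ w d = w k := by
        have aux : ∀ d, k < d → d ≤ 2 * n → w d = w k → k + 1 < d := by
          intro d hd _ hdk
          rcases Nat.lt_or_ge (k + 1) d with h | h
          · exact h
          · obtain rfl : d = k + 1 := by omega
            exact absurd hdk.symm (hne k hk)
        by_cases h0 : w k = w 0
        · exact ⟨2 * n, aux _ hk le_rfl (by rw [hw, h0]), le_rfl, by rw [hw, h0]⟩
        · have hkT : w k ∈ T := Finset.mem_erase.2 ⟨h0, hmem k hk.le⟩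
          have h3 : l (w k) ≠ k := fun h => h2 (Finset.mem_image.2 ⟨_, hkT, h⟩)
          have h4 : ¬ l (w k) < k := fun h => hl_last _ hkT k h hk.le rfl
          exact ⟨_, aux _ (by omega) (hl _ hkT).le (hlB _ hkT), (hl _ hkT).le, hlB _ hkT⟩
      have hearlier : ∃ a, a < k ∧ w a = w (k + 1) := by
        have aux : ∀ a ≤ k, w a = w (k + 1) → a < k := by
          intro a ha hak
          refine lt_of_le_of_ne ha ?_
          rintro rfl
          exact hne a hk hak
        by_cases h0 : w (k + 1) = w 0
        · exact ⟨0, aux 0 (Nat.zero_le _) h0.symm, h0.symm⟩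
        · have hkT : w (k + 1) ∈ T := Finset.mem_erase.2 ⟨h0, hmem _ hk⟩
          have h3 : i (w (k + 1)) ≠ k := fun h => h1 (Finset.mem_image.2 ⟨_, hkT, h⟩)
          have h4 : ¬ k < i (w (k + 1)) := fun h => hi_first _ hkT (k + 1) h rfl
          exact ⟨i (w (k + 1)) + 1, aux _ (by omega) (hiB _ hkT), hiB _ hkT⟩
      obtain ⟨d, hd, hd', hdk⟩ := hlater
      obtain ⟨a, ha, hak⟩ := hearlier
      exact hne k hk ((hnc' a k (k + 1) d ha (by omega) hd hd' hak hdk.symm).symm.trans hak)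
  have hdisj : Disjoint (T.image i) (T.image l) := by
    rw [← Finset.card_union_eq_card_add_card, hcover, Finset.card_range,
      Finset.card_image_of_injOn hi_inj, Finset.card_image_of_injOn hl_inj, hTcard]
    omega
  rw [← hcover, Finset.sum_union hdisj, Finset.sum_image hi_inj, Finset.sum_image hl_inj,
    ← Finset.sum_add_distrib]
  refine Finset.sum_eq_zero fun B hB => ?_
  have hil : i B < l B := by
    by_contra h
    exact hi_first B hB (l B) (by omega) (hlB B hB)
  have hnpop : ∀ B' ∈ T, l B' ≠ i B := fun B' hB' h =>
    Finset.disjoint_left.1 hdisj (Finset.mem_image_of_mem i hB) (Finset.mem_image.2 ⟨B', hB', h⟩)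
  have hnpush : ∀ B' ∈ T, i B' ≠ l B := fun B' hB' h =>
    Finset.disjoint_left.1 hdisj (Finset.mem_image.2 ⟨B', hB', h⟩) (Finset.mem_image_of_mem l hB)
  have hiB' := hi B hB
  have hlB' := hl B hB
  have hneA : w (i B) ≠ B := hi_first B hB _ le_rfl
  have hneD : w (l B + 1) ≠ B := hl_last B hB _ (Nat.lt_succ_self _) hlB'
  have hA : ∃ d, l B < d ∧ d ≤ 2 * n ∧ w d = w (i B) := by
    by_cases h0 : w (i B) = w 0
    · exact ⟨2 * n, hlB', le_rfl, by rw [hw, h0]⟩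
    · have hAT : w (i B) ∈ T := Finset.mem_erase.2
        ⟨h0, Finset.mem_image_of_mem _ (Finset.mem_range.2 hiB')⟩
      refine ⟨l (w (i B)), ?_, (hl _ hAT).le, hlB _ hAT⟩
      have h3 := hnpop _ hAT
      have h4 : ¬ l (w (i B)) < i B := fun h => hl_last _ hAT _ h hiB'.le rfl
      have h5 : l (w (i B)) ≠ i B + 1 := fun h => hneA <| by
        rw [← hlB _ hAT, h, hiB B hB]
      have h6 : l (w (i B)) ≠ l B := fun h => hneA <| by
        rw [← hlB _ hAT, h, hlB B hB]
      by_contra h7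
      refine hneA ((hnc' (i B) (i B + 1) (l (w (i B))) (l B) (by omega) (by omega) (by omega)
        hlB'.le (hlB _ hAT).symm ?_).trans (hiB B hB))
      rw [hiB B hB, hlB B hB]
  have hD : ∃ a, a ≤ i B ∧ w a = w (l B + 1) := by
    by_cases h0 : w (l B + 1) = w 0
    · exact ⟨0, Nat.zero_le _, h0.symm⟩
    · have hlt : l B + 1 < 2 * n := by
        refine lt_of_le_of_ne hlB' fun h => h0 ?_
        rw [h, hw]
      have hDT : w (l B + 1) ∈ T := Finset.mem_erase.2
        ⟨h0, Finset.mem_image_of_mem _ (Finset.mem_range.2 hlt)⟩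
      refine ⟨i (w (l B + 1)) + 1, ?_, hiB _ hDT⟩
      have h3 := hnpush _ hDT
      have h4 : ¬ l B < i (w (l B + 1)) := fun h => hi_first _ hDT (l B + 1) h rfl
      have h5 : i (w (l B + 1)) ≠ i B := fun h => hneD <| by
        rw [← hiB _ hDT, h, hiB B hB]
      have h6 : i (w (l B + 1)) + 1 ≠ l B := fun h => hneD <| by
        rw [← hiB _ hDT, h, hlB B hB]
      by_contra h7
      refine hneD ((hiB _ hDT).symm.trans ((hnc' (i B + 1) (i (w (l B + 1)) + 1) (l B) (l B + 1)
        (by omega) (by omega) (by omega) hlB' ?_ (hiB _ hDT)).symm.trans (hiB B hB)))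
      rw [hiB B hB, hlB B hB]
  have hAD : w (l B + 1) = w (i B) := by
    obtain ⟨d, hd, hd', hdA⟩ := hA
    obtain ⟨a, ha, haD⟩ := hD
    rcases ha.eq_or_lt with rfl | ha
    · exact haD.symm
    rcases Nat.lt_or_ge (l B + 1) d with h | h
    · exact haD.symm.trans (hnc' a (i B) (l B + 1) d ha (by omega) h hd' haD hdA.symm)
    · obtain rfl : d = l B + 1 := by omega
      exact hdA
  have hcB := hc _ hiB'
  rw [hiB B hB] at hcB
  rw [hAD, hiB B hB, hlB B hB, hcB, hG B, neg_smul, add_neg_cancel]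

/-- The wedge of the standard basis vectors indexed by an `(n - 1)`-element set. -/
noncomputable def basisWedge (n : ℕ) (C : Finset (Fin (2 * n))) :
    ExteriorAlgebra ℝ (Fin (2 * n) → ℝ) :=
  if h : C.card = n - 1 then
    ExteriorAlgebra.ιMulti ℝ (n - 1) (fun i => Pi.single (C.orderEmbOfFin h i) (1 : ℝ))
  else 0

theorem unmCoord_single {n : ℕ} (a : Fin (2 * n)) (i : ℕ) :
    unmCoord (Pi.single a (1 : ℝ)) i = if (a : ℕ) = 2 * i then 1 else 0 := by
  unfold unmCoord
  have ha := a.2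
  split_ifs with h1 h2 h2
  · rw [show (⟨2 * i, h1⟩ : Fin (2 * n)) = a from Fin.ext h2.symm, Pi.single_eq_same]
  · exact Pi.single_eq_of_ne (fun h => h2 (by rw [← h])) _
  · omega
  · rfl

theorem tldCoord_single {n : ℕ} (a : Fin (2 * n)) (i : ℕ) :
    tldCoord (Pi.single a (1 : ℝ)) i = if (a : ℕ) = 2 * i + 1 then 1 else 0 := by
  unfold tldCoord
  have ha := a.2
  split_ifs with h1 h2 h2
  · rw [show (⟨2 * i + 1, h1⟩ : Fin (2 * n)) = a from Fin.ext h2.symm, Pi.single_eq_same]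
  · exact Pi.single_eq_of_ne (fun h => h2 (by rw [← h])) _
  · omega
  · rfl

theorem Omega_single_single {n : ℕ} (a b : Fin (2 * n)) (hab : a < b) :
    Omega n (Pi.single a 1) (Pi.single b 1) =
      (if (b : ℕ) = a + 1 then (-1 : ℝ) ^ (a : ℕ) else 0) +
        (if (a : ℕ) = 0 ∧ (b : ℕ) = 2 * n - 1 then (-1 : ℝ) ^ n else 0) := by
  have ha := a.2
  have hb := b.2
  have hab' : (a : ℕ) < b := hab
  unfold Omega
  simp only [unmCoord_single, tldCoord_single]
  have h1 : ∑ i ∈ Finset.range n,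
      ((if (a : ℕ) = 2 * i then (1 : ℝ) else 0) * (if (b : ℕ) = 2 * i + 1 then 1 else 0) -
        (if (a : ℕ) = 2 * i + 1 then 1 else 0) * (if (b : ℕ) = 2 * i then 1 else 0)) =
      if (b : ℕ) = a + 1 ∧ (a : ℕ) % 2 = 0 then 1 else 0 := by
    rw [Finset.sum_eq_single ((a : ℕ) / 2)]
    · split_ifs <;> first | omega | norm_num
    · intro i _ hi
      split_ifs <;> first | omega | norm_num
    · intro h
      rw [Finset.mem_range] at h
      omega
  have h2 : ∑ j ∈ Finset.range (n - 1),
      ((if (a : ℕ) = 2 * (j + 1) then (1 : ℝ) else 0) * (if (b : ℕ) = 2 * j + 1 then 1 else 0) -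
        (if (a : ℕ) = 2 * j + 1 then 1 else 0) * (if (b : ℕ) = 2 * (j + 1) then 1 else 0)) =
      if (b : ℕ) = a + 1 ∧ (a : ℕ) % 2 = 1 then -1 else 0 := by
    rw [Finset.sum_eq_single ((a : ℕ) / 2)]
    · split_ifs <;> first | omega | norm_num
    · intro i _ hi
      split_ifs <;> first | omega | norm_num
    · intro h
      rw [Finset.mem_range] at h
      split_ifs <;> first | omega | norm_num
  rw [h1, h2]
  congr 1
  · rcases Nat.even_or_odd (a : ℕ) with h | h
    · have h' := Nat.even_iff.1 h
      simp [h.neg_one_pow, h']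
    · have h' := Nat.odd_iff.1 h
      simp [h.neg_one_pow, h']
  · split_ifs <;> first | omega | norm_num

theorem erase2_basisFam {n : ℕ} (A : Finset (Fin (2 * n))) (h : A.card = n + 1)
    (p q : Fin (n + 1)) (hpq : p < q) :
    ExteriorAlgebra.ιMulti ℝ (n - 1) (erase2 (basisFam n A h) p q) =
      basisWedge n (A \ {A.orderEmbOfFin h p, A.orderEmbOfFin h q}) := by
  have hcard : (A \ {A.orderEmbOfFin h p, A.orderEmbOfFin h q}).card = n - 1 := by
    rw [Finset.card_sdiff_of_subset, h, Finset.card_pair]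
    · omega
    · exact fun e => hpq.ne ((A.orderEmbOfFin h).injective e)
    · intro x hx
      rcases Finset.mem_insert.1 hx with rfl | hx
      · exact Finset.orderEmbOfFin_mem _ _ _
      · rw [Finset.mem_singleton.1 hx]
        exact Finset.orderEmbOfFin_mem _ _ _
  have hpq' : (p : ℕ) < q := hpq
  have hq := q.2
  rw [basisWedge, dif_pos hcard]
  congr 1
  have key : erase2 (A.orderEmbOfFin h) p q =
      (A \ {A.orderEmbOfFin h p, A.orderEmbOfFin h q}).orderEmbOfFin hcard := by
    apply Finset.orderEmbOfFin_unique hcard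
    · intro x
      have hx := x.2
      simp only [erase2, Finset.mem_sdiff, Finset.mem_insert, Finset.mem_singleton, not_or,
        EmbeddingLike.apply_eq_iff_eq, Fin.ext_iff]
      refine ⟨Finset.orderEmbOfFin_mem _ _ _, ?_⟩
      rw [Nat.mod_eq_of_lt (by split_ifs <;> omega)]
      split_ifs <;> omega
    · intro x y hxy
      have hx := x.2
      have hy := y.2
      have hxy' : (x : ℕ) < y := hxy
      simp only [erase2, OrderEmbedding.lt_iff_lt, Fin.lt_def]
      rw [Nat.mod_eq_of_lt (by split_ifs <;> omega), Nat.mod_eq_of_lt (by split_ifs <;> omega)]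
      split_ifs <;> omega
  funext x
  rw [← key]
  rfl

/-- The residue of `k` as a position on the circle of length `2 * n`. -/
def circlePos {n : ℕ} (hn : 0 < n) (k : ℕ) : Fin (2 * n) :=
  ⟨k % (2 * n), Nat.mod_lt _ (by omega)⟩

theorem kappaSimple_basisFam {n : ℕ} (hn : 0 < n) (A : Finset (Fin (2 * n)))
    (h : A.card = n + 1) :
    kappaSimple (Fin (2 * n) → ℝ) (Omega n) (basisFam n A h) =
      ∑ k ∈ Finset.range (2 * n),
        if circlePos hn k ∈ A ∧ circlePos hn (k + 1) ∈ A then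
          (-1 : ℝ) ^ k • basisWedge n (A \ {circlePos hn k, circlePos hn (k + 1)}) else 0 := by
  have hval : ∀ k < 2 * n, (circlePos hn k : ℕ) = k := fun k hk => Nat.mod_eq_of_lt hk
  have hval0 : (circlePos hn (2 * n - 1 + 1) : ℕ) = 0 := by
    rw [Nat.sub_add_cancel (by omega)]
    exact Nat.mod_self _
  set F : Fin (2 * n) → Fin (2 * n) → ExteriorAlgebra ℝ (Fin (2 * n) → ℝ) := fun a b =>
    (∑ k ∈ Finset.range (2 * n - 1), if a = circlePos hn k ∧ b = circlePos hn (k + 1) then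
        (-1 : ℝ) ^ k • basisWedge n (A \ {circlePos hn k, circlePos hn (k + 1)}) else 0) +
      (if a = circlePos hn (2 * n - 1 + 1) ∧ b = circlePos hn (2 * n - 1) then
        (-1 : ℝ) ^ (2 * n - 1) •
          basisWedge n (A \ {circlePos hn (2 * n - 1), circlePos hn (2 * n - 1 + 1)}) else 0)
    with hF
  have hF' : ∀ a b, F a b = ((if (b : ℕ) = a + 1 then (-1 : ℝ) ^ (a : ℕ) else 0) +
        (if (a : ℕ) = 0 ∧ (b : ℕ) = 2 * n - 1 then -1 else 0)) • basisWedge n (A \ {a, b}) := by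
    intro a b
    have ha := a.2
    have hb := b.2
    rw [hF, add_smul]
    dsimp only
    congr 1
    · by_cases hab : (b : ℕ) = a + 1
      · have e1 : circlePos hn a = a := Fin.ext (hval _ ha)
        have e2 : circlePos hn (a + 1) = b := Fin.ext (by rw [hval _ (by omega), hab])
        rw [if_pos hab, Finset.sum_eq_single (a : ℕ)]
        · rw [e1, e2, if_pos ⟨rfl, rfl⟩]
        · intro k hk hka
          rw [Finset.mem_range] at hk
          exact if_neg fun e => hka (by rw [e.1, hval _ (by omega)])
        · intro hk
          rw [Finset.mem_range] at hk
          omega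
      · rw [if_neg hab, zero_smul]
        refine Finset.sum_eq_zero fun k hk => if_neg ?_
        rintro ⟨rfl, rfl⟩
        rw [Finset.mem_range] at hk
        rw [hval _ (by omega), hval _ (by omega)] at hab
        exact hab rfl
    · have : (a = circlePos hn (2 * n - 1 + 1) ∧ b = circlePos hn (2 * n - 1)) ↔
          ((a : ℕ) = 0 ∧ (b : ℕ) = 2 * n - 1) := by
        rw [Fin.ext_iff, Fin.ext_iff, hval0, hval _ (by omega)]
      by_cases hab : (a : ℕ) = 0 ∧ (b : ℕ) = 2 * n - 1
      · rw [if_pos (this.2 hab), if_pos hab, ← (this.2 hab).1, ← (this.2 hab).2,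
          Odd.neg_one_pow ⟨n - 1, by omega⟩, Finset.pair_comm]
      · rw [if_neg (mt this.1 hab), if_neg hab, zero_smul]
  have hkappa : kappaSimple (Fin (2 * n) → ℝ) (Omega n) (basisFam n A h) =
      ∑ p, ∑ q, F (A.orderEmbOfFin h p) (A.orderEmbOfFin h q) := by
    unfold kappaSimple
    refine Finset.sum_congr rfl fun p _ => Finset.sum_congr rfl fun q _ => ?_
    rw [hF']
    have hp := p.2
    have hq := q.2
    by_cases hpq : p < q
    · have hlt := (A.orderEmbOfFin h).strictMono hpq
      have hΩ : Omega n (basisFam n A h p) (basisFam n A h q) = _ :=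
        Omega_single_single (A.orderEmbOfFin h p) (A.orderEmbOfFin h q) hlt
      rw [if_pos (Fin.lt_def.1 hpq), erase2_basisFam A h p q hpq, hΩ, mul_add]
      congr 2
      · split_ifs with hs
        · have : (q : ℕ) = p + 1 := by
            by_contra hne
            have hpq' : (p : ℕ) < q := hpq
            let r : Fin (n + 1) := ⟨p + 1, by omega⟩
            have h1 : A.orderEmbOfFin h p < A.orderEmbOfFin h r :=
              (A.orderEmbOfFin h).strictMono (Fin.lt_def.2 (Nat.lt_succ_self _))
            have h2 : A.orderEmbOfFin h r < A.orderEmbOfFin h q :=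
              (A.orderEmbOfFin h).strictMono (Fin.lt_def.2 (by change (p : ℕ) + 1 < q; omega))
            rw [Fin.lt_def] at h1 h2
            omega
          rw [this, Even.neg_one_pow ⟨(p : ℕ) + 1, by ring⟩, one_mul]
        · rw [mul_zero]
      · split_ifs with hs
        · obtain ⟨hs0, hs1⟩ := hs
          have hp0 : (p : ℕ) = 0 := by
            by_contra hne
            have h1 := (A.orderEmbOfFin h).strictMono (show (0 : Fin (n + 1)) < p from
              Fin.lt_def.2 (Nat.pos_of_ne_zero hne))
            rw [Fin.lt_def] at h1
            omega
          have hqn : (q : ℕ) = n := by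
            by_contra hne
            have h1 := (A.orderEmbOfFin h).strictMono (show q < Fin.last n from
              Fin.lt_def.2 (by change (q : ℕ) < n; omega))
            have h2 := (A.orderEmbOfFin h (Fin.last n)).2
            rw [Fin.lt_def] at h1
            omega
          rw [hp0, hqn, ← pow_add]
          exact Odd.neg_one_pow ⟨n, by ring⟩
        · rw [mul_zero]
    · have hle := (A.orderEmbOfFin h).monotone (not_lt.1 hpq)
      rw [Fin.le_def] at hle
      rw [if_neg (mt Fin.lt_def.2 hpq), if_neg (by omega), if_neg (by omega), add_zero, zero_smul]
  have hsum : ∀ f : Fin (2 * n) → ExteriorAlgebra ℝ (Fin (2 * n) → ℝ),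
      ∑ p, f (A.orderEmbOfFin h p) = ∑ a ∈ A, f a := by
    intro f
    conv_rhs => rw [← Finset.map_orderEmbOfFin_univ A h, Finset.sum_map]
    rfl
  have hite : ∀ (x y : Fin (2 * n)) (m : ExteriorAlgebra ℝ (Fin (2 * n) → ℝ)),
      ∑ a ∈ A, ∑ b ∈ A, (if a = x ∧ b = y then m else 0) = if x ∈ A ∧ y ∈ A then m else 0 := by
    intro x y m
    simp only [ite_and, Finset.sum_ite_irrel, Finset.sum_ite_eq', Finset.sum_const_zero]
  have hrange : Finset.range (2 * n) = Finset.range (2 * n - 1 + 1) := by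
    rw [Nat.sub_add_cancel (by omega)]
  rw [hkappa, Finset.sum_congr rfl fun p _ => hsum (F (A.orderEmbOfFin h p)),
    hsum fun a => ∑ b ∈ A, F a b, hrange, Finset.sum_range_succ]
  simp only [hF, Finset.sum_add_distrib]
  rw [hite]
  congr 1
  · rw [Finset.sum_congr rfl fun a _ => Finset.sum_comm, Finset.sum_comm]
    exact Finset.sum_congr rfl fun k _ => hite _ _ _
  · simp only [and_comm]

/-- The sum of the basis wedges over all sets that miss the blocks `X` and `Y` of `P` and meet
every other block in exactly one element. -/
noncomputable def missingPairSum {n : ℕ} (P : Finpartition (Finset.univ : Finset (Fin (2 * n))))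
    (X Y : Finset (Fin (2 * n))) : ExteriorAlgebra ℝ (Fin (2 * n) → ℝ) :=
  ∑ C ∈ (Finset.univ.powersetCard (n - 1)).filter
    (fun C => ∀ B ∈ P.parts, (C ∩ B).card = if B = X ∨ B = Y then 0 else 1), basisWedge n C

theorem missingPairSum_comm {n : ℕ} (P : Finpartition (Finset.univ : Finset (Fin (2 * n))))
    (X Y : Finset (Fin (2 * n))) : missingPairSum P X Y = missingPairSum P Y X := by
  simp only [missingPairSum, or_comm]

theorem sum_concordant_sdiff_pair {n : ℕ} (hn : 0 < n)
    (P : Finpartition (Finset.univ : Finset (Fin (2 * n)))) (x y : Fin (2 * n))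
    (hxy : P.part x ≠ P.part y) :
    (∑ A ∈ (Finset.univ.powersetCard (n + 1)).filter
      (fun A => Concordant A P ∧ x ∈ A ∧ y ∈ A), basisWedge n (A \ {x, y})) =
      missingPairSum P (P.part x) (P.part y) := by
  have hne : x ≠ y := fun h => hxy (by rw [h])
  have hpart : ∀ B ∈ P.parts, ∀ z, z ∈ B ↔ B = P.part z := fun B hB z =>
    ⟨fun hz => (P.part_eq_of_mem hB hz).symm, fun h => h ▸ P.mem_part (Finset.mem_univ z)⟩
  have hnotMem : ∀ C : Finset (Fin (2 * n)), (∀ B ∈ P.parts,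
      (C ∩ B).card = if B = P.part x ∨ B = P.part y then 0 else 1) → x ∉ C ∧ y ∉ C := by
    intro C hC
    have haux : ∀ z, P.part z = P.part x ∨ P.part z = P.part y → z ∉ C := by
      intro z hz hzC
      have h1 := hC _ (P.part_mem.2 (Finset.mem_univ z))
      rw [if_pos hz, Finset.card_eq_zero] at h1
      exact Finset.notMem_empty z
        (h1 ▸ Finset.mem_inter.2 ⟨hzC, P.mem_part (Finset.mem_univ z)⟩)
    exact ⟨haux x (Or.inl rfl), haux y (Or.inr rfl)⟩
  have hinter : ∀ C : Finset (Fin (2 * n)), x ∉ C → y ∉ C → ∀ B ∈ P.parts,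
      ((C ∪ {x, y}) ∩ B).card = (C ∩ B).card + if B = P.part x ∨ B = P.part y then 1 else 0 := by
    intro C hx hy B hB
    have hdisj : Disjoint (C ∩ B) (({x, y} : Finset (Fin (2 * n))) ∩ B) := by
      refine Finset.disjoint_left.2 fun z hz hz' => ?_
      have h1 := (Finset.mem_inter.1 hz).1
      rcases Finset.mem_insert.1 (Finset.mem_inter.1 hz').1 with rfl | h2
      · exact hx h1
      · exact hy (Finset.mem_singleton.1 h2 ▸ h1)
    rw [Finset.union_inter_distrib_right, Finset.card_union_of_disjoint hdisj]
    congr 1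
    by_cases h1 : B = P.part x
    · have hxB := (hpart B hB x).2 h1
      have hyB : y ∉ B := fun h => hxy (h1 ▸ (hpart B hB y).1 h)
      rw [if_pos (Or.inl h1), Finset.insert_inter_of_mem hxB,
        Finset.singleton_inter_of_notMem hyB]
      rfl
    · have hxB := mt (hpart B hB x).1 h1
      rw [Finset.insert_inter_of_notMem hxB]
      by_cases h2 : B = P.part y
      · rw [if_pos (Or.inr h2), Finset.singleton_inter_of_mem ((hpart B hB y).2 h2)]
        rfl
      · rw [if_neg (not_or.2 ⟨h1, h2⟩),
          Finset.singleton_inter_of_notMem (mt (hpart B hB y).1 h2)]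
        rfl
  have hsub : ∀ A : Finset (Fin (2 * n)), x ∈ A → y ∈ A → {x, y} ⊆ A := fun A hx hy => by
    simp [Finset.insert_subset_iff, hx, hy]
  unfold missingPairSum
  refine Finset.sum_bij' (fun A _ => A \ {x, y}) (fun C _ => C ∪ {x, y}) ?_ ?_ ?_ ?_ ?_
  · intro A hA
    simp only [Finset.mem_filter, Finset.mem_powersetCard_univ] at hA ⊢
    obtain ⟨hAc, hA, hx, hy⟩ := hA
    refine ⟨by rw [Finset.card_sdiff_of_subset (hsub A hx hy), hAc, Finset.card_pair hne]; omega,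
      fun B hB => ?_⟩
    have h1 := hinter (A \ {x, y}) (by simp) (by simp) B hB
    rw [Finset.sdiff_union_of_subset (hsub A hx hy), hA B hB] at h1
    split_ifs at h1 ⊢ <;> omega
  · intro C hC
    simp only [Finset.mem_filter, Finset.mem_powersetCard_univ] at hC ⊢
    obtain ⟨hCc, hC⟩ := hC
    obtain ⟨hx, hy⟩ := hnotMem C hC
    refine ⟨?_, fun B hB => ?_, by simp, by simp⟩
    · rw [Finset.card_union_of_disjoint (by simp [hx, hy]), Finset.card_pair hne, hCc]
      omega
    · rw [hinter C hx hy B hB, hC B hB]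
      split_ifs <;> rfl
  · intro A hA
    simp only [Finset.mem_filter] at hA
    exact Finset.sdiff_union_of_subset (hsub A hA.2.2.1 hA.2.2.2)
  · intro C hC
    obtain ⟨hx, hy⟩ := hnotMem C (Finset.mem_filter.1 hC).2
    exact Finset.union_sdiff_cancel_right (by simp [hx, hy])
  · intro A _
    rfl

/-- For any noncrossing partition σ of [n], the vector f_σ lies in the kernel
of κ: applying κ term by term to f_σ = ∑_{(I,Ĩ) concordant} e_{I,Ĩ} gives 0. -/
theorem kappa_fSigma_eq_zero (n : ℕ)
    (P : Finpartition (Finset.univ : Finset (Fin (2 * n))))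
    (hP : IsKrewerasPair P) :
    (∑ A ∈ ((Finset.univ : Finset (Fin (2 * n))).powersetCard (n + 1)).attach,
      if Concordant A.1 P then
        kappaSimple (Fin (2 * n) → ℝ) (Omega n)
          (basisFam n A.1 (Finset.mem_powersetCard.mp A.2).2)
      else 0) = 0 := by
  classical
  obtain ⟨hnc, hpar, hcard⟩ := hP
  have hn : 0 < n := by
    rcases Nat.eq_zero_or_pos n with rfl | h
    · have h1 : P.parts.card ≤ (Finset.univ : Finset (Fin (2 * 0))).card := P.card_parts_le_card
      rw [hcard] at h1
      simp at h1
    · exact h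
  set w : ℕ → Finset (Fin (2 * n)) := fun k => P.part (circlePos hn k) with hw
  have hmem : ∀ k, circlePos hn k ∈ w k := fun k => P.mem_part (Finset.mem_univ _)
  have hparts : ∀ k, w k ∈ P.parts := fun k => P.part_mem.2 (Finset.mem_univ _)
  have hval : ∀ k < 2 * n, (circlePos hn k : ℕ) = k := fun k hk => Nat.mod_eq_of_lt hk
  have hmod : ∀ k, (circlePos hn k : ℕ) % 2 = k % 2 := fun k => Nat.mod_mul_right_mod k 2 n
  have hparity : ∀ k, ∀ z ∈ w k, (z : ℕ) % 2 = k % 2 := by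
    intro k z hz
    have h1 := hmod k
    rcases hpar _ (hparts k) with h | h <;>
    · have h2 := h _ (hmem k)
      have h3 := h z hz
      omega
  have hne : ∀ k, w k ≠ w (k + 1) := by
    intro k h
    have h1 := hparity k _ (h ▸ hmem (k + 1))
    have h2 := hmod (k + 1)
    omega
  set c : Finset (Fin (2 * n)) → ℝ := fun B => if ∃ z ∈ B, (z : ℕ) % 2 = 0 then 1 else -1
  have hcw : ∀ k, c (w k) = (-1) ^ k := by
    intro k
    rcases Nat.even_or_odd k with h | h
    · rw [h.neg_one_pow]
      refine if_pos ⟨_, hmem k, ?_⟩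
      rw [hmod, Nat.even_iff.1 h]
    · rw [h.neg_one_pow]
      refine if_neg ?_
      rintro ⟨z, hz, hz'⟩
      rw [hparity k z hz, Nat.odd_iff.1 h] at hz'
      omega
  have himage : (Finset.range (2 * n)).image w = P.parts := by
    apply Finset.Subset.antisymm
    · intro B hB
      obtain ⟨k, -, rfl⟩ := Finset.mem_image.1 hB
      exact hparts k
    · intro B hB
      obtain ⟨z, hz⟩ := P.nonempty_of_mem_parts hB
      refine Finset.mem_image.2 ⟨z, Finset.mem_range.2 z.2, ?_⟩
      rw [hw]
      dsimp only
      rw [show circlePos hn z = z from Fin.ext (hval _ z.2), P.part_eq_of_mem hB hz]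
  have hwalk := sum_closed_walk_eq_zero (n := n) w
    (by simp [hw, circlePos]) (fun k _ => hne k)
    (by
      intro a b c d hab hbc hcd hd hac hbd
      by_contra h
      refine hnc _ (hparts a) _ (hparts b) h ⟨circlePos hn a, circlePos hn b, circlePos hn c,
        circlePos hn d, ?_, ?_, ?_, hmem a, hac ▸ hmem c, hmem b, hbd ▸ hmem d⟩ <;>
      · rw [Fin.lt_def, hval _ (by omega), hval _ (by omega)]
        assumption)
    (by rw [himage, hcard]) c (fun k _ => by rw [hcw, hcw, pow_succ, mul_neg_one])
    (missingPairSum P) (missingPairSum_comm P)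
  refine Eq.trans ?_ hwalk
  set K : Finset (Fin (2 * n)) → ExteriorAlgebra ℝ (Fin (2 * n) → ℝ) := fun A =>
    ∑ k ∈ Finset.range (2 * n),
      if Concordant A P ∧ circlePos hn k ∈ A ∧ circlePos hn (k + 1) ∈ A then
        (-1 : ℝ) ^ k • basisWedge n (A \ {circlePos hn k, circlePos hn (k + 1)}) else 0 with hK
  trans ∑ A ∈ ((Finset.univ : Finset (Fin (2 * n))).powersetCard (n + 1)).attach, K A.1
  · refine Finset.sum_congr rfl fun A _ => ?_
    by_cases hA : Concordant A.1 P
    · simp only [hK, if_true, kappaSimple_basisFam hn, hA, true_and]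
    · simp only [hK, hA, false_and, if_false, Finset.sum_const_zero]
  · rw [Finset.sum_attach _ K, Finset.sum_comm]
    refine Finset.sum_congr rfl fun k _ => ?_
    rw [← Finset.sum_filter, ← Finset.smul_sum, sum_concordant_sdiff_pair hn P _ _ (hne k), hcw]
end
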